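/- In Version C, every position in which all pile sizes are even is a P-position. -/

import Mathlib

/-- Remove one token from a pile of size `p` in `G`: delete one copy of `p` and,
if `p ≠ 1`, add back a pile of size `p - 1`. -/
def takeOne (G : Multiset ℕ) (p : ℕ) : Multiset ℕ :=
  G.erase p + (if p = 1 then (0 : Multiset ℕ) else {p - 1})

/-- Legal moves of Version C: remove one token from one chosen pile, or choose two
piles (counted with multiplicity) and remove one token from each of them
(piles reaching size 0 are deleted). -/
inductive MoveC : Multiset ℕ → Multiset ℕ → Prop
  | one {G : Multiset ℕ} {p : ℕ} (hp : p ∈ G) (h1 : 1 ≤ p) : MoveC G (takeOne G p)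
  | two {G : Multiset ℕ} {p q : ℕ} (hp : p ∈ G) (hq : q ∈ G.erase p)
      (h1 : 1 ≤ p) (h2 : 1 ≤ q) : MoveC G (takeOne (takeOne G p) q)

mutual
  /-- P-positions of Version C under normal play: every move leads to an N-position
  (in particular the empty position is a P-position).  Since every move strictly
  decreases the total number of tokens, this inductive definition agrees with the
  usual recursive definition of outcome classes. -/
  inductive PPosC : Multiset ℕ → Prop
    | mk : ∀ {G : Multiset ℕ}, (∀ H, MoveC G H → NPosC H) → PPosC G
  /-- N-positions of Version C under normal play: some move leads to a P-position. -/
  inductive NPosC : Multiset ℕ → Prop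
    | mk : ∀ {G H : Multiset ℕ}, MoveC G H → PPosC H → NPosC G
end

theorem takeOne_cons (p : ℕ) (R : Multiset ℕ) :
    takeOne (p ::ₘ R) p = R + (if p = 1 then (0 : Multiset ℕ) else {p - 1}) := by
  simp [takeOne]

theorem takeOne_cons_of_ne_one {p : ℕ} (hp : p ≠ 1) (R : Multiset ℕ) :
    takeOne (p ::ₘ R) p = (p - 1) ::ₘ R := by
  rw [takeOne_cons, if_neg hp, add_comm, Multiset.singleton_add]

/-- The pile left over when two tokens are removed from a pile of size `p`. -/
def pileSubTwo (p : ℕ) : Multiset ℕ :=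
  if p - 1 = 1 then 0 else {p - 1 - 1}

theorem takeOne_pred_cons (p : ℕ) (R : Multiset ℕ) :
    takeOne ((p - 1) ::ₘ R) (p - 1) = R + pileSubTwo p :=
  takeOne_cons _ _

theorem sum_pileSubTwo_lt {p : ℕ} (hp : 1 ≤ p) : (pileSubTwo p).sum < p := by
  unfold pileSubTwo
  split_ifs <;> simp <;> omega

theorem pos_and_even_of_mem_pileSubTwo {p x : ℕ} (hp : 1 ≤ p) (he : Even p)
    (hx : x ∈ pileSubTwo p) : 1 ≤ x ∧ Even x := by
  unfold pileSubTwo at hx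
  rw [Nat.even_iff] at *
  split_ifs at hx
  · simp at hx
  · rw [Multiset.mem_singleton] at hx
    omega

theorem PPosC.of_pos_and_even (G : Multiset ℕ) (h : ∀ p ∈ G, 1 ≤ p ∧ Even p) : PPosC G := by
  induction hn : G.sum using Nat.strong_induction_on generalizing G with
  | _ n ih =>
  subst hn
  refine .mk fun H hH => ?_
  have ne_one : ∀ p ∈ G, p ≠ 1 := by
    rintro p hp rfl
    exact absurd (h 1 hp).2 (by decide)
  cases hH with
  | @one p hp h1 =>
    have hp1 := ne_one p hp
    obtain ⟨R, rfl⟩ := Multiset.exists_cons_of_mem hp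
    rw [takeOne_cons_of_ne_one hp1]
    refine .mk (.one (Multiset.mem_cons_self (p - 1) R) (by omega)) ?_
    rw [takeOne_pred_cons]
    refine ih _ ?_ _ ?_ rfl
    · have := sum_pileSubTwo_lt h1
      simp only [Multiset.sum_add, Multiset.sum_cons]
      omega
    · intro x hx
      rcases Multiset.mem_add.1 hx with hx | hx
      · exact h x (Multiset.mem_cons_of_mem hx)
      · exact pos_and_even_of_mem_pileSubTwo h1 (h p hp).2 hx
  | @two p q hp hq h1 h2 =>
    have hp1 := ne_one p hp
    have hqG := Multiset.mem_of_mem_erase hq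
    have hq1 := ne_one q hqG
    obtain ⟨R', rfl⟩ := Multiset.exists_cons_of_mem hp
    rw [Multiset.erase_cons_head] at hq
    obtain ⟨R, rfl⟩ := Multiset.exists_cons_of_mem hq
    rw [takeOne_cons_of_ne_one hp1, Multiset.cons_swap, takeOne_cons_of_ne_one hq1,
      Multiset.cons_swap]
    refine .mk (.two (Multiset.mem_cons_self (p - 1) _) (q := q - 1) ?_
      (by omega) (by omega)) ?_
    · simp
    rw [takeOne_pred_cons, Multiset.cons_add, takeOne_pred_cons]
    refine ih _ ?_ _ ?_ rfl
    · have := sum_pileSubTwo_lt h1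
      have := sum_pileSubTwo_lt h2
      simp only [Multiset.sum_add, Multiset.sum_cons]
      omega
    · intro x hx
      rcases Multiset.mem_add.1 hx with hx | hx
      · rcases Multiset.mem_add.1 hx with hx | hx
        · exact h x (Multiset.mem_cons_of_mem (Multiset.mem_cons_of_mem hx))
        · exact pos_and_even_of_mem_pileSubTwo h1 (h p hp).2 hx
      · exact pos_and_even_of_mem_pileSubTwo h2 (h q hqG).2 hx

/-- In Version C, every position in which all pile sizes are even is a P-position. -/
theorem versionC_allEven_PPos (G : Multiset ℕ) (hG : 0 ∉ G)
    (h : ∀ p ∈ G, Even p) : PPosC G := by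
  refine PPosC.of_pos_and_even G fun p hp => ⟨Nat.one_le_iff_ne_zero.2 ?_, h p hp⟩
  rintro rfl
  exact hG hp
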